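/- (Number of summands in the Steenrod square formula.) Let i ≤ j be natural numbers, and set p = q = j, n = j − i, m = i + j. The number of strictly increasing tuples 0 ≤ i_0 < i_1 < ⋯ < i_n ≤ m satisfying onesPlus(i) = j − n and onesMinus(i) = j − n equals C(⌊m/2⌋, ⌊n/2⌋) · C(⌊(m+1)/2⌋, ⌊(n+1)/2⌋). -/

import Mathlib

/-- The value `i_t` of an index tuple `0 ≤ i_0 < i_1 < ⋯ < i_n ≤ m`, regarded as a
strictly monotone function `Fin (n+1) → Fin (m+1)`, extended by `0` outside range. -/
def ival (n m : ℕ) (i : Fin (n + 1) → Fin (m + 1)) (t : ℕ) : ℕ :=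
  if h : t ≤ n then (i ⟨t, Nat.lt_succ_of_le h⟩ : ℕ) else 0

/-- Block lengths of the word `(i_0,…,i_n)_m`: `b_0 = i_0`,
`b_j = i_j − i_{j−1} − 1` for `1 ≤ j ≤ n`, and `b_{n+1} = m − i_n`. -/
def blockLen (n m : ℕ) (i : Fin (n + 1) → Fin (m + 1)) (j : ℕ) : ℕ :=
  if j = 0 then ival n m i 0
  else if j ≤ n then ival n m i j - ival n m i (j - 1) - 1
  else m - ival n m i n

/-- The number of letters `1` in the word `(i_0,…,i_n)_m^+`: the sum of the
block lengths `b_j` over odd `j` with `0 ≤ j ≤ n+1`. -/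
def onesPlus (n m : ℕ) (i : Fin (n + 1) → Fin (m + 1)) : ℕ :=
  ∑ j ∈ Finset.range (n + 2), if Odd j then blockLen n m i j else 0

/-- The number of letters `1` in the word `(i_0,…,i_n)_m^-`: the sum of the
block lengths `b_j` over even `j` with `0 ≤ j ≤ n+1`. -/
def onesMinus (n m : ℕ) (i : Fin (n + 1) → Fin (m + 1)) : ℕ :=
  ∑ j ∈ Finset.range (n + 2), if Even j then blockLen n m i j else 0

/-- Stars and bars: the number of `ℕ`-valued functions on a finite type with sum `k`. -/
lemma card_fun_sum_eq (α : Type*) [Fintype α] (k : ℕ) :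
    Nat.card {f : α → ℕ // ∑ a, f a = k} = Nat.multichoose (Fintype.card α) k := by
  classical
  rw [← Nat.card_congr (Sym.equivNatSumOfFintype α k), Nat.card_eq_fintype_card,
    Sym.card_sym_eq_multichoose]

/-- The number of `ℕ`-valued functions whose sums on and off a predicate are prescribed. -/
lemma card_fun_sum_filter_eq (α : Type*) [Fintype α] (p : α → Prop) [DecidablePred p]
    (k l : ℕ) :
    Nat.card {f : α → ℕ // (∑ a with p a, f a) = k ∧ (∑ a with ¬ p a, f a) = l} =
      Nat.multichoose (Fintype.card {a // p a}) k *
        Nat.multichoose (Fintype.card {a // ¬ p a}) l := by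
  rw [← card_fun_sum_eq, ← card_fun_sum_eq, ← Nat.card_prod]
  refine Nat.card_congr (((Equiv.piEquivPiSubtypeProd p fun _ => ℕ).subtypeEquiv
    fun f => ?_).trans Equiv.subtypeProdEquivProd)
  rw [Finset.sum_subtype _ (p := p) (by simp), Finset.sum_subtype _ (p := fun a => ¬ p a) (by simp)]
  rfl

lemma card_fin_odd (k : ℕ) : Fintype.card {a : Fin k // Odd (a : ℕ)} = k / 2 := by
  rw [Fintype.card_subtype, Finset.card_filter,
    Fin.sum_univ_eq_sum_range (fun a => if Odd a then 1 else 0)]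
  induction k with
  | zero => rfl
  | succ k ih =>
    rw [Finset.sum_range_succ, ih]
    split_ifs with h <;> rw [Nat.odd_iff] at h <;> lia

lemma card_fin_not_odd (k : ℕ) : Fintype.card {a : Fin k // ¬ Odd (a : ℕ)} = (k + 1) / 2 := by
  rw [Fintype.card_subtype_compl, card_fin_odd, Fintype.card_fin]
  lia

lemma Nat.multichoose_succ_eq_choose (a k : ℕ) :
    Nat.multichoose (a + 1) k = Nat.choose (a + k) a := by
  rw [Nat.multichoose_eq, show a + 1 + k - 1 = a + k by lia, Nat.choose_symm_add]

section blocks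

variable {n m : ℕ} {t : Fin (n + 1) → Fin (m + 1)}

lemma ival_lt_ival_succ (ht : StrictMono t) {k : ℕ} (hk : k + 1 ≤ n) :
    ival n m t k < ival n m t (k + 1) := by
  rw [ival, ival, dif_pos (by lia), dif_pos hk]
  exact ht (Fin.mk_lt_mk.2 k.lt_succ_self)

lemma sum_blockLen_add (ht : StrictMono t) {k : ℕ} (hk : k ≤ n) :
    ∑ j ∈ Finset.range (k + 1), blockLen n m t j + k = ival n m t k := by
  induction k with
  | zero => simp [blockLen]
  | succ k ih =>
    have hlt := ival_lt_ival_succ ht hk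
    have := ih (by lia)
    rw [Finset.sum_range_succ, blockLen, if_neg k.succ_ne_zero, if_pos hk, Nat.add_sub_cancel]
    lia

lemma ext_of_blockLen {s : Fin (n + 1) → Fin (m + 1)} (hs : StrictMono s) (ht : StrictMono t)
    (h : ∀ j < n + 2, blockLen n m s j = blockLen n m t j) : s = t := by
  ext k
  have hk : (k : ℕ) ≤ n := by lia
  have key : ival n m s k = ival n m t k := by
    rw [← sum_blockLen_add hs hk, ← sum_blockLen_add ht hk]
    congr 1
    exact Finset.sum_congr rfl fun j hj => h j (by have := Finset.mem_range.1 hj; lia)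
  simpa [ival, hk] using key

/-- Every sequence of block lengths with total `m - n` comes from an index tuple. -/
lemma exists_strictMono_blockLen_eq (b : ℕ → ℕ)
    (hb : ∑ j ∈ Finset.range (n + 2), b j + n = m) :
    ∃ t : Fin (n + 1) → Fin (m + 1), StrictMono t ∧ ∀ j < n + 2, blockLen n m t j = b j := by
  have hmono : StrictMono fun k => ∑ j ∈ Finset.range (k + 1), b j + k :=
    strictMono_nat_of_lt_succ fun k => by rw [Finset.sum_range_succ _ (k + 1)]; lia
  have htop : ∑ j ∈ Finset.range (n + 1), b j + b (n + 1) + n = m := by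
    rw [← Finset.sum_range_succ, hb]
  have hle (k : Fin (n + 1)) : ∑ j ∈ Finset.range (k + 1), b j + k < m + 1 := by
    have := hmono.monotone (show (k : ℕ) ≤ n by lia)
    lia
  refine ⟨fun k => ⟨_, hle k⟩, fun k l hkl => hmono hkl, fun j hj => ?_⟩
  have hival (k : ℕ) (hk : k ≤ n) : ival n m (fun k => ⟨_, hle k⟩) k =
      ∑ j ∈ Finset.range (k + 1), b j + k := by simp [ival, hk]
  unfold blockLen
  split_ifs with h0 hjn
  · simp [hival, h0]
  · obtain ⟨k, rfl⟩ := Nat.exists_eq_succ_of_ne_zero h0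
    rw [hival _ hjn, Nat.succ_sub_one, hival _ (by lia), Finset.sum_range_succ]
    lia
  · obtain rfl : j = n + 1 := by lia
    rw [hival _ le_rfl]
    lia

lemma onesPlus_eq_sum_filter :
    onesPlus n m t = ∑ j : Fin (n + 2) with Odd (Fin.val j), blockLen n m t j := by
  rw [onesPlus, Finset.sum_filter,
    Fin.sum_univ_eq_sum_range (fun j => if Odd j then blockLen n m t j else 0)]

lemma onesMinus_eq_sum_filter :
    onesMinus n m t = ∑ j : Fin (n + 2) with ¬ Odd (Fin.val j), blockLen n m t j := by
  simp only [onesMinus, Finset.sum_filter, Nat.not_odd_iff_even]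
  rw [Fin.sum_univ_eq_sum_range (fun j => if Even j then blockLen n m t j else 0)]

/-- Counting index tuples is counting their sequences of block lengths. -/
lemma card_strictMono_onesPlus_onesMinus (k l : ℕ) (h : k + l + n = m) :
    Nat.card {t : Fin (n + 1) → Fin (m + 1) // StrictMono t ∧
        onesPlus n m t = k ∧ onesMinus n m t = l} =
      Nat.card {f : Fin (n + 2) → ℕ // (∑ a with Odd (Fin.val a), f a) = k ∧
        (∑ a with ¬ Odd (Fin.val a), f a) = l} := by
  refine Nat.card_eq_of_bijective (fun t => ⟨fun j => blockLen n m t.1 j,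
    onesPlus_eq_sum_filter.symm.trans t.2.2.1, onesMinus_eq_sum_filter.symm.trans t.2.2.2⟩)
    ⟨fun s t hst => Subtype.ext (ext_of_blockLen s.2.1 t.2.1 fun j hj => ?_), fun f => ?_⟩
  · exact congrFun (congrArg Subtype.val hst) ⟨j, hj⟩
  · obtain ⟨f, hk, hl⟩ := f
    let b (j : ℕ) : ℕ := if hj : j < n + 2 then f ⟨j, hj⟩ else 0
    have hbf (j : Fin (n + 2)) : b j = f j := by simp [b]
    obtain ⟨t, ht, htb⟩ := exists_strictMono_blockLen_eq (m := m) (n := n) b (by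
      rw [← Fin.sum_univ_eq_sum_range, Finset.sum_congr rfl fun j _ => hbf j,
        ← Finset.sum_filter_add_sum_filter_not _ (fun a : Fin (n + 2) => Odd (a : ℕ)), hk, hl, h])
    have htf (j : Fin (n + 2)) : blockLen n m t j = f j := (htb j j.2).trans (hbf j)
    refine ⟨⟨t, ht, ?_, ?_⟩, Subtype.ext (funext htf)⟩
    · rw [onesPlus_eq_sum_filter, ← hk, Finset.sum_congr rfl fun j _ => htf j]
    · rw [onesMinus_eq_sum_filter, ← hl, Finset.sum_congr rfl fun j _ => htf j]

end blocks

/-- The number of summands in the formula for the chain-level Steenrod square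
`Sq^i` applied to a `j`-cochain (`i ≤ j`, `n = j − i`, `m = i + j`), i.e. the
number of strictly increasing tuples `0 ≤ i_0 < ⋯ < i_n ≤ m` with
`onesPlus = j − n = onesMinus`, is `C(⌊m/2⌋, ⌊n/2⌋) · C(⌊(m+1)/2⌋, ⌊(n+1)/2⌋)`. -/
theorem card_steenrod_summands (i j n m : ℕ) (hij : i ≤ j)
    (hn : n = j - i) (hm : m = i + j) :
    Nat.card {t : Fin (n + 1) → Fin (m + 1) // StrictMono t ∧
        onesPlus n m t = j - n ∧ onesMinus n m t = j - n} =
      Nat.choose (m / 2) (n / 2) * Nat.choose ((m + 1) / 2) ((n + 1) / 2) := by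
  have hjn : j - n = i := by lia
  rw [hjn, card_strictMono_onesPlus_onesMinus i i (by lia), card_fun_sum_filter_eq,
    card_fin_odd, card_fin_not_odd, show (n + 2) / 2 = n / 2 + 1 by lia,
    show (n + 2 + 1) / 2 = (n + 1) / 2 + 1 by lia, Nat.multichoose_succ_eq_choose,
    Nat.multichoose_succ_eq_choose, show n / 2 + i = m / 2 by lia,
    show (n + 1) / 2 + i = (m + 1) / 2 by lia]
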